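/- Let F, ε_F = s + t·θ_F, p, the Shintani set R_{F,p}, and the map π(r) = p·r + pO_F be as in the context. Then the kernel of π (equivalently, the set R_{F,p} ∩ O_F) is exactly { 1 − {s·i/t}_{[0,1)} + (i/t)·ε_F : i = 0, 1, …, t−1 }, where {x}_{[0,1)} denotes the fractional part of x. In particular, |ker(π)| = t. -/

import Mathlib

open NumberField IntermediateField

/-- The Shintani set `R_{F,p} = { r₁ + r₂·ε ∈ (1/p)O_F : r₁ ∈ ℚ ∩ (0,1], r₂ ∈ ℚ ∩ [0,1) }`,
viewed as a set of real numbers. -/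
def shintaniSet (F : IntermediateField ℚ ℝ) [NumberField F] (p : ℕ) (ε : ℝ) : Set ℝ :=
  {x | ∃ r₁ r₂ : ℚ, x = (r₁ : ℝ) + (r₂ : ℝ) * ε ∧ 0 < r₁ ∧ r₁ ≤ 1 ∧ 0 ≤ r₂ ∧ r₂ < 1 ∧
    ∃ y : NumberField.RingOfIntegers F, ((y : F) : ℝ) = (p : ℝ) * x}

lemma aux_irr (θ : ℝ) (h : Irrational θ) (a b : ℚ) (hab : (a : ℝ) + b * θ = 0) : a = 0 ∧ b = 0 := by
  have hb : b = 0 := by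
    by_contra hb
    apply h
    have hb' : (b : ℝ) ≠ 0 := by exact_mod_cast hb
    refine ⟨-a / b, ?_⟩
    push_cast
    field_simp
    linarith
  subst hb
  simp at hab
  exact ⟨hab, rfl⟩

lemma aux_pos (θ ε : ℝ) (h : Irrational θ) (τ n s t T : ℤ) (hq : θ ^ 2 = τ * θ + n)
    (hpos : 0 < 2 * θ - τ) (hε : ε = s + t * θ) (hε1 : 1 < ε)
    (hT : ε ^ 2 - (T : ℝ) * ε + 1 = 0) : 0 < t := by
  have h1 : (((s ^ 2 + t ^ 2 * n - T * s + 1 : ℤ) : ℚ) : ℝ)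
      + (((2 * s * t + t ^ 2 * τ - T * t : ℤ) : ℚ) : ℝ) * θ = 0 := by
    push_cast
    subst hε
    linear_combination hT - (t : ℝ) ^ 2 * hq
  obtain ⟨h2, h3⟩ := aux_irr θ h _ _ h1
  have h2' : s ^ 2 + t ^ 2 * n - T * s + 1 = 0 := by exact_mod_cast h2
  have h3' : 2 * s * t + t ^ 2 * τ - T * t = 0 := by exact_mod_cast h3
  by_cases ht : t = 0
  · subst ht
    have hs : s ∣ 1 := ⟨T - s, by linarith⟩
    have hs1 : (1 : ℤ) < s := by
      have : (1 : ℝ) < s := by simpa [hε] using hε1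
      exact_mod_cast this
    have := Int.le_of_dvd one_pos hs
    omega
  · have hTe : T = 2 * s + t * τ := by
      apply mul_left_cancel₀ ht
      linarith
    have h4 : (T : ℝ) < 2 * ε := by nlinarith
    have h5 : 0 < (t : ℝ) * (2 * θ - τ) := by
      rw [hTe, hε] at h4
      push_cast at h4
      linarith
    have h6 : 0 < (t : ℝ) := pos_of_mul_pos_left h5 hpos.le
    exact_mod_cast h6

lemma aux_eq (θ ε : ℝ) (s t i : ℤ) (ht : 0 < t) (hε : ε = s + t * θ) :
    1 - Int.fract ((s : ℝ) * (i : ℝ) / (t : ℝ)) + ((i : ℝ) / (t : ℝ)) * ε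
      = ((1 + ⌊(s : ℝ) * (i : ℝ) / (t : ℝ)⌋ : ℤ) : ℝ) + (i : ℝ) * θ := by
  have ht' : (t : ℝ) ≠ 0 := by exact_mod_cast ht.ne'
  rw [Int.fract, hε]
  push_cast
  field_simp
  ring

/-- With `ε_F = s + t·θ_F`, the kernel of `π : R_{F,p} → O_F/pO_F`,
`π(r) = p·r + pO_F` (equivalently, the set `R_{F,p} ∩ O_F`) is exactly
`{ 1 − {s·i/t}_{[0,1)} + (i/t)·ε_F : i = 0, 1, …, t−1 }`; in particular it has `t`
elements. -/
theorem explicit_kernel_of_shintani_map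
    (d p : ℕ) (hd1 : 1 < d) (hdsq : Squarefree d)
    (F : IntermediateField ℚ ℝ) [NumberField F]
    (hF : F = ℚ⟮(Real.sqrt d)⟯)
    (hhF : NumberField.classNumber F = 1)
    (θ : ℝ) (hθ : θ = if d % 4 = 1 then (1 + Real.sqrt d) / 2 else Real.sqrt d)
    (hOF : ∀ x : ℝ, (∃ y : 𝓞 F, ((y : F) : ℝ) = x) ↔ ∃ a b : ℤ, x = (a : ℝ) + (b : ℝ) * θ)
    [Fact p.Prime] (hp7 : 7 ≤ p) (hp4 : p % 4 = 3)
    (hleg : legendreSym p (d : ℤ) = -1)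
    (hinert : (Ideal.span {(p : 𝓞 F)}).IsPrime)
    (ε : ℝ) (s t : ℤ) (hεst : ε = (s : ℝ) + (t : ℝ) * θ)
    (hεunit : ∃ u : (𝓞 F)ˣ, (((u : 𝓞 F) : F) : ℝ) = ε)
    (hε1 : 1 < ε)
    (hεnorm : ∃ T : ℤ, ε ^ 2 - (T : ℝ) * ε + 1 = 0)
    (hεfund : ∀ x : ℝ, 0 < x → 1 < x →
      (∃ u : (𝓞 F)ˣ, (((u : 𝓞 F) : F) : ℝ) = x) →
      (∃ T : ℤ, x ^ 2 - (T : ℝ) * x + 1 = 0) → ε ≤ x) :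
    {x : ℝ | x ∈ shintaniSet F p ε ∧ ∃ w : 𝓞 F, ((w : F) : ℝ) = x} =
      {x : ℝ | ∃ i : ℤ, 0 ≤ i ∧ i < t ∧
        x = 1 - Int.fract ((s : ℝ) * (i : ℝ) / (t : ℝ)) + ((i : ℝ) / (t : ℝ)) * ε} ∧
    (Nat.card {x : ℝ | x ∈ shintaniSet F p ε ∧ ∃ w : 𝓞 F, ((w : F) : ℝ) = x} : ℤ) = t := by
  have hirr : Irrational (Real.sqrt d) := by
    rw [irrational_sqrt_natCast_iff]
    rintro ⟨k, hk⟩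
    have := hdsq k ⟨1, by rw [hk]; ring⟩
    rw [Nat.isUnit_iff] at this
    subst this
    omega
  have hsq : Real.sqrt d ^ 2 = d := Real.sq_sqrt (by positivity)
  have hspos : 0 < Real.sqrt d := Real.sqrt_pos.2 (by positivity)
  obtain ⟨T, hT⟩ := hεnorm
  have key : Irrational θ ∧ 0 < t := by
    by_cases h4 : d % 4 = 1
    · rw [if_pos h4] at hθ
      have hi : Irrational θ := by
        rw [hθ]
        have h1 := (hirr.ratCast_add 1).div_ratCast (q := 2) (by norm_num)
        simpa using h1
      refine ⟨hi, aux_pos θ ε hi 1 ((d / 4 : ℕ) : ℤ) s t T ?_ ?_ hεst hε1 hT⟩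
      · have h5 : (d : ℝ) = 4 * ((d / 4 : ℕ) : ℝ) + 1 := by
          exact_mod_cast (by omega : d = 4 * (d / 4) + 1)
        rw [hθ, Int.cast_natCast]
        push_cast
        linear_combination hsq / 4 + h5 / 4
      · rw [hθ]; push_cast; linarith
    · rw [if_neg h4] at hθ
      have hi : Irrational θ := by rw [hθ]; exact hirr
      refine ⟨hi, aux_pos θ ε hi 0 (d : ℤ) s t T ?_ ?_ hεst hε1 hT⟩
      · rw [hθ, hsq]; simp
      · rw [hθ]; push_cast; linarith
  obtain ⟨hi, ht⟩ := key
  have htR : (0 : ℝ) < t := by exact_mod_cast ht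
  have htQ : (0 : ℚ) < t := by exact_mod_cast ht
  have hset : {x : ℝ | x ∈ shintaniSet F p ε ∧ ∃ w : 𝓞 F, ((w : F) : ℝ) = x} =
      {x : ℝ | ∃ i : ℤ, 0 ≤ i ∧ i < t ∧
        x = 1 - Int.fract ((s : ℝ) * (i : ℝ) / (t : ℝ)) + ((i : ℝ) / (t : ℝ)) * ε} := by
    ext x
    simp only [Set.mem_setOf_eq]
    constructor
    · rintro ⟨⟨r₁, r₂, hx, h1, h2, h3, h4, -⟩, hw⟩
      obtain ⟨a, b, hab⟩ := (hOF x).1 hw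
      obtain ⟨e1, e2⟩ := aux_irr θ hi (r₁ + r₂ * s - a) (r₂ * t - b) (by
        push_cast
        rw [hx, hεst] at hab
        linear_combination hab)
      have hb : r₂ = b / t := by
        rw [eq_div_iff htQ.ne']; linarith
      have hb0 : (0 : ℚ) ≤ b := by
        have := mul_nonneg h3 htQ.le
        linarith
      have hbt : (b : ℚ) < t := by nlinarith
      refine ⟨b, by exact_mod_cast hb0, by exact_mod_cast hbt, ?_⟩
      have hfr : Int.fract ((s : ℝ) * (b : ℝ) / (t : ℝ)) = 1 - r₁ := by
        rw [Int.fract_eq_iff]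
        refine ⟨?_, ?_, a - 1, ?_⟩
        · have : (r₁ : ℝ) ≤ 1 := by exact_mod_cast h2
          linarith
        · have : (0 : ℝ) < r₁ := by exact_mod_cast h1
          linarith
        · have e : (s : ℚ) * b / t - (1 - r₁) = ((a - 1 : ℤ) : ℚ) := by
            push_cast
            rw [hb] at e1
            linear_combination e1
          exact_mod_cast e
      rw [hfr, hx, hb]
      push_cast
      ring
    · rintro ⟨i, hi0, hit, hx⟩
      have hx2 := hx
      rw [aux_eq θ ε s t i ht hεst] at hx2
      refine ⟨⟨1 - Int.fract ((s : ℚ) * i / t), i / t, ?_, ?_, ?_, ?_, ?_, ?_⟩, ?_⟩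
      · rw [hx]
        push_cast
        rfl
      · linarith [Int.fract_lt_one ((s : ℚ) * i / t)]
      · linarith [Int.fract_nonneg ((s : ℚ) * i / t)]
      · have : (0 : ℚ) ≤ i := by exact_mod_cast hi0
        positivity
      · rw [div_lt_one htQ]; exact_mod_cast hit
      · rw [hOF]
        refine ⟨p * (1 + ⌊(s : ℝ) * (i : ℝ) / (t : ℝ)⌋), p * i, ?_⟩
        rw [hx2]
        push_cast
        ring
      · rw [hOF]
        exact ⟨_, _, hx2⟩
  refine ⟨hset, ?_⟩
  rw [hset]
  have himg : {x : ℝ | ∃ i : ℤ, 0 ≤ i ∧ i < t ∧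
        x = 1 - Int.fract ((s : ℝ) * (i : ℝ) / (t : ℝ)) + ((i : ℝ) / (t : ℝ)) * ε} =
      (fun i : ℤ => 1 - Int.fract ((s : ℝ) * (i : ℝ) / (t : ℝ)) + ((i : ℝ) / (t : ℝ)) * ε) ''
        Set.Ico 0 t := by
    ext x
    simp only [Set.mem_setOf_eq, Set.mem_image, Set.mem_Ico]
    constructor
    · rintro ⟨i, h0, h1, h⟩
      exact ⟨i, ⟨h0, h1⟩, h.symm⟩
    · rintro ⟨i, ⟨h0, h1⟩, h⟩
      exact ⟨i, h0, h1, h.symm⟩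
  rw [himg, Nat.card_image_of_injective]
  · simp [ht.le]
  · intro i j hij
    simp only at hij
    rw [aux_eq θ ε s t i ht hεst, aux_eq θ ε s t j ht hεst] at hij
    have := (aux_irr θ hi
      (((1 + ⌊(s : ℝ) * (i : ℝ) / (t : ℝ)⌋ : ℤ) : ℚ) - ((1 + ⌊(s : ℝ) * (j : ℝ) / (t : ℝ)⌋ : ℤ) : ℚ))
      ((i : ℚ) - j) (by
        push_cast at hij ⊢
        linear_combination hij)).2
    have h := sub_eq_zero.1 this
    exact_mod_cast h
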